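/- Let D⊂ℝ^d be a bounded connected open domain with C³ boundary, Π an open set with Π̄⊂D, ν>0, T>0, ρ>0. Let a∈C(Q̄_T,ℝ^d) be continuously differentiable in x with sup_{(t,x)∈Q_T}(|a(t,x)| + |∇_x a(t,x)|) ≤ ρ. Then there exist numbers q<1 and δ>0, depending only on T, ρ, ν, and Π (and D), such that every solution w∈C^{1,2}(Q̄_T) of ∂_t w − νΔw + div(a(t,x)w) = 0 with w|_{∂D}=0 satisfies at least one of the two inequalities: ‖w(T,·)‖_{L¹(D)} ≤ q‖w(0,·)‖_{L¹(D)}, or inf_{x∈Π}|w(T,x)| ≥ δ‖w(0,·)‖_{L¹(D)}. -/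

import Mathlib

open Set MeasureTheory Filter Topology

noncomputable section

/-- `d`-dimensional Euclidean space. -/
abbrev Euc (d : ℕ) : Type := EuclideanSpace ℝ (Fin d)

/-- The `j`-th vector of the standard basis. -/
def ebasis (d : ℕ) (j : Fin d) : Euc d := EuclideanSpace.single j 1

/-- Time derivative `∂ₜ u (t,x)`. -/
def dtt {d : ℕ} (u : ℝ → Euc d → ℝ) (t : ℝ) (x : Euc d) : ℝ := deriv (fun s => u s x) t

/-- First spatial differential. -/
def dx1 {d : ℕ} (f : Euc d → ℝ) (x : Euc d) : Euc d →L[ℝ] ℝ := fderiv ℝ f x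

/-- Second spatial differential. -/
def dx2 {d : ℕ} (f : Euc d → ℝ) (x : Euc d) : Euc d →L[ℝ] Euc d →L[ℝ] ℝ :=
  fderiv ℝ (fun y => fderiv ℝ f y) x

/-- Laplacian `Δf(x)`. -/
def lapl {d : ℕ} (f : Euc d → ℝ) (x : Euc d) : ℝ :=
  ∑ j : Fin d, dx2 f x (ebasis d j) (ebasis d j)

/-- `div_x A(f) (x) = Σⱼ ∂_{xⱼ} (Aⱼ(f x))`. -/
def divA {d : ℕ} (A : ℝ → Fin d → ℝ) (f : Euc d → ℝ) (x : Euc d) : ℝ :=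
  ∑ j : Fin d, fderiv ℝ (fun y => A (f y) j) x (ebasis d j)

/-- `div (a(t,·) w(t,·)) (x) = Σⱼ ∂_{xⱼ} (aⱼ(t,x) w(t,x))`. -/
def divAW {d : ℕ} (a : ℝ → Euc d → Euc d) (w : ℝ → Euc d → ℝ) (t : ℝ) (x : Euc d) : ℝ :=
  ∑ j : Fin d, fderiv ℝ (fun y => a t y j * w t y) x (ebasis d j)

/-- The boundary of `D` is of class `C³`: near each boundary point, `D` is the sublevel
set of a `C³` function with non-vanishing differential. -/
def HasC3Boundary {d : ℕ} (D : Set (Euc d)) : Prop :=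
  ∀ x ∈ frontier D, ∃ (U : Set (Euc d)) (ψ : Euc d → ℝ),
    IsOpen U ∧ x ∈ U ∧ ContDiff ℝ 3 ψ ∧ (∀ y ∈ U, fderiv ℝ ψ y ≠ 0) ∧
    D ∩ U = {y ∈ U | ψ y < 0}

/-- A bounded connected open domain with `C³` boundary. -/
def GoodDomain {d : ℕ} (D : Set (Euc d)) : Prop :=
  IsOpen D ∧ IsConnected D ∧ Bornology.IsBounded D ∧ HasC3Boundary D

/-- `u ∈ C^{1,2}(J × D̄)`: continuous on the closed cylinder, once continuously
differentiable in `t` and twice in `x`. -/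
def IsC12On {d : ℕ} (J : Set ℝ) (D : Set (Euc d)) (u : ℝ → Euc d → ℝ) : Prop :=
  ContinuousOn (fun p : ℝ × Euc d => u p.1 p.2) (J ×ˢ closure D) ∧
  (∀ x ∈ closure D, ∀ t ∈ J, DifferentiableAt ℝ (fun s => u s x) t) ∧
  (∀ t ∈ J, ∀ x ∈ closure D, DifferentiableAt ℝ (u t) x) ∧
  (∀ t ∈ J, ∀ x ∈ closure D, DifferentiableAt ℝ (fun y => fderiv ℝ (u t) y) x) ∧
  ContinuousOn (fun p : ℝ × Euc d => dtt u p.1 p.2) (J ×ˢ closure D) ∧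
  ContinuousOn (fun p : ℝ × Euc d => dx1 (u p.1) p.2) (J ×ˢ closure D) ∧
  ContinuousOn (fun p : ℝ × Euc d => dx2 (u p.1) p.2) (J ×ˢ closure D)

/-- `N` bounds both the sup-norm and the parabolic Hölder seminorm of exponent `γ`
of `f` on `J × D̄`. -/
def parHolderBound {d : ℕ} {Y : Type*} [NormedAddCommGroup Y] (γ : ℝ) (J : Set ℝ)
    (D : Set (Euc d)) (f : ℝ → Euc d → Y) (N : ℝ) : Prop :=
  (∀ t ∈ J, ∀ x ∈ closure D, ‖f t x‖ ≤ N) ∧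
  ∀ t₁ ∈ J, ∀ t₂ ∈ J, ∀ x₁ ∈ closure D, ∀ x₂ ∈ closure D,
    ‖f t₁ x₁ - f t₂ x₂‖ ≤ N * (|t₁ - t₂| ^ (γ / 2) + ‖x₁ - x₂‖ ^ γ)

/-- The parabolic Hölder norm `|||f|||_γ` on `J × D̄` (up to equivalence). -/
def parHolderNorm {d : ℕ} {Y : Type*} [NormedAddCommGroup Y] (γ : ℝ) (J : Set ℝ)
    (D : Set (Euc d)) (f : ℝ → Euc d → Y) : ℝ :=
  sInf {N : ℝ | 0 ≤ N ∧ parHolderBound γ J D f N}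

/-- `h ∈ C^{γ/2,γ}(J × D̄)`. -/
def MemParHolder {d : ℕ} (γ : ℝ) (J : Set ℝ) (D : Set (Euc d)) (h : ℝ → Euc d → ℝ) : Prop :=
  ContinuousOn (fun p : ℝ × Euc d => h p.1 p.2) (J ×ˢ closure D) ∧
  ∃ N, parHolderBound γ J D h N

/-- `N` bounds the `X^γ(J × D̄)` norm of `u`. -/
def XgammaBound {d : ℕ} (γ : ℝ) (J : Set ℝ) (D : Set (Euc d)) (u : ℝ → Euc d → ℝ)
    (N : ℝ) : Prop :=
  (∀ t ∈ J, ∀ x ∈ closure D, |u t x| ≤ N) ∧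
  parHolderBound γ J D (fun t x => dtt u t x) N ∧
  parHolderBound γ J D (fun t x => dx1 (u t) x) N ∧
  parHolderBound γ J D (fun t x => dx2 (u t) x) N

/-- The `X^γ(J × D̄)` norm (up to equivalence). -/
def XgammaNorm {d : ℕ} (γ : ℝ) (J : Set ℝ) (D : Set (Euc d)) (u : ℝ → Euc d → ℝ) : ℝ :=
  sInf {N : ℝ | 0 ≤ N ∧ XgammaBound γ J D u N}

/-- `u ∈ X^γ(J × D̄)`. -/
def MemXgamma {d : ℕ} (γ : ℝ) (J : Set ℝ) (D : Set (Euc d)) (u : ℝ → Euc d → ℝ) : Prop :=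
  IsC12On J D u ∧ ∃ N, XgammaBound γ J D u N

/-- `N` bounds the sup and the `γ`-Hölder seminorm of `f` on `S`. -/
def holderBoundOn {X Y : Type*} [NormedAddCommGroup X] [NormedAddCommGroup Y]
    (γ : ℝ) (S : Set X) (f : X → Y) (N : ℝ) : Prop :=
  (∀ x ∈ S, ‖f x‖ ≤ N) ∧ ∀ x ∈ S, ∀ y ∈ S, ‖f x - f y‖ ≤ N * ‖x - y‖ ^ γ

/-- `N` bounds the `C^{2+γ}(D̄)` norm of `g`. -/
def C2gammaBound {d : ℕ} (γ : ℝ) (D : Set (Euc d)) (g : Euc d → ℝ) (N : ℝ) : Prop :=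
  holderBoundOn γ (closure D) g N ∧
  holderBoundOn γ (closure D) (fun x => dx1 g x) N ∧
  holderBoundOn γ (closure D) (fun x => dx2 g x) N

/-- The `C^{2+γ}(D̄)` norm (up to equivalence). -/
def C2gammaNorm {d : ℕ} (γ : ℝ) (D : Set (Euc d)) (g : Euc d → ℝ) : ℝ :=
  sInf {N : ℝ | 0 ≤ N ∧ C2gammaBound γ D g N}

/-- `g ∈ C^{2+γ}(D̄)`. -/
def MemC2gamma {d : ℕ} (γ : ℝ) (D : Set (Euc d)) (g : Euc d → ℝ) : Prop :=
  (∀ x ∈ closure D, DifferentiableAt ℝ g x ∧ DifferentiableAt ℝ (fun y => fderiv ℝ g y) x) ∧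
  ∃ N, C2gammaBound γ D g N

/-- `u` satisfies `∂ₜu + div_x A(u) - ν Δu = h` for `t ∈ Jpde`, `x ∈ D`. -/
def SolvesPDE {d : ℕ} (ν : ℝ) (A : ℝ → Fin d → ℝ) (Jpde : Set ℝ) (D : Set (Euc d))
    (h u : ℝ → Euc d → ℝ) : Prop :=
  ∀ t ∈ Jpde, ∀ x ∈ D, dtt u t x + divA A (u t) x - ν * lapl (u t) x = h t x

/-- Homogeneous Dirichlet boundary condition on `J × ∂D`. -/
def DirichletBC {d : ℕ} (J : Set ℝ) (D : Set (Euc d)) (u : ℝ → Euc d → ℝ) : Prop :=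
  ∀ t ∈ J, ∀ x ∈ frontier D, u t x = 0

/-- The compatibility conditions on `∂D`. -/
def CompatCond {d : ℕ} (ν : ℝ) (A : ℝ → Fin d → ℝ) (D : Set (Euc d))
    (h : ℝ → Euc d → ℝ) (u₀ : Euc d → ℝ) : Prop :=
  ∀ x ∈ frontier D, u₀ x = 0 ∧ divA A u₀ x - ν * lapl u₀ x - h 0 x = 0

/-- The sign condition (S): `(Σⱼ Aⱼ'(u)) sgn u ≥ c|u| - C`. -/
def SignCondition {d : ℕ} (A : ℝ → Fin d → ℝ) (c C : ℝ) : Prop :=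
  ∀ u : ℝ, c * |u| - C ≤ (∑ j : Fin d, deriv (fun v => A v j) u) * Real.sign u

/-- The `L¹(D)` norm. -/
def L1norm {d : ℕ} (D : Set (Euc d)) (f : Euc d → ℝ) : ℝ := ∫ x in D, |f x|

/-- The `L^∞(D)` norm (of a bounded continuous function). -/
def supNorm {d : ℕ} (D : Set (Euc d)) (f : Euc d → ℝ) : ℝ :=
  sSup ((fun x => |f x|) '' closure D)

/-- The piecewise constant control from Theorem 2.2: `ξ(t) = ξₖ` for
`t ∈ [k - 1/2, k - 1/2 + τₖ)` (where `k - 1 ≤ t < k`, `k ≥ 1`) and `ξ(t) = 0` otherwise. -/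
def ctrl (ξs τs : ℕ → ℝ) (t : ℝ) : ℝ :=
  Set.indicator
    (Set.Ico (((⌊t⌋₊ + 1 : ℕ) : ℝ) - 1/2) ((((⌊t⌋₊ + 1 : ℕ) : ℝ) - 1/2) + τs (⌊t⌋₊ + 1)))
    (fun _ => ξs (⌊t⌋₊ + 1)) t

/-- `ξ` is piecewise constant on `[0, T]`. -/
def PiecewiseConstOn (ξ : ℝ → ℝ) (T : ℝ) : Prop :=
  ∃ n : ℕ, ∃ τ : ℕ → ℝ, τ 0 = 0 ∧ τ n = T ∧ (∀ k < n, τ k < τ (k + 1)) ∧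
    ∀ k < n, ∀ t ∈ Ico (τ k) (τ (k + 1)), ξ t = ξ (τ k)

/-- `u` is the solution of the controlled problem with control `ξ(t) φ(x)`: a continuous curve
in `C^{2+γ}(D̄)` satisfying the initial and boundary conditions and solving the PDE on every
interval of constancy of `ξ` (i.e. at every time at which `ξ` is locally constant). -/
def IsCtrlSolOn {d : ℕ} (γ ν : ℝ) (A : ℝ → Fin d → ℝ) (D : Set (Euc d))
    (h : ℝ → Euc d → ℝ) (φ : Euc d → ℝ) (ξ : ℝ → ℝ) (u₀ : Euc d → ℝ)
    (J Jo : Set ℝ) (u : ℝ → Euc d → ℝ) : Prop :=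
  ContinuousOn (fun p : ℝ × Euc d => u p.1 p.2) (J ×ˢ closure D) ∧
  (∀ t ∈ J, MemC2gamma γ D (u t)) ∧
  DirichletBC J D u ∧
  (∀ x ∈ closure D, u 0 x = u₀ x) ∧
  ∀ t ∈ Jo, (∀ᶠ s in nhds t, ξ s = ξ t) →
    (∀ x ∈ closure D, DifferentiableAt ℝ (fun s => u s x) t) ∧
    ∀ x ∈ D, dtt u t x + divA A (u t) x - ν * lapl (u t) x = h t x + ξ t * φ x


/-- Extending a function by zero to the left of a zero of it and of its derivative. -/
theorem hasDerivAt_piecewise_zero {f f' : ℝ → ℝ} (hf : ∀ r, 0 ≤ r → HasDerivAt f (f' r) r)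
    (h0 : f 0 = 0) (h0' : f' 0 = 0) (r : ℝ) :
    HasDerivAt (fun r => if 0 ≤ r then f r else 0) (if 0 ≤ r then f' r else 0) r := by
  rcases lt_trichotomy r 0 with hr | rfl | hr
  · rw [if_neg hr.not_ge]
    refine (hasDerivAt_const r (0 : ℝ)).congr_of_eventuallyEq ?_
    filter_upwards [Iio_mem_nhds hr] with y hy
    rw [if_neg (not_le.mpr hy)]
  · rw [if_pos le_rfl, h0']
    have hl : HasDerivWithinAt (fun r => if 0 ≤ r then f r else 0) 0 (Iic 0) 0 := by
      refine (hasDerivWithinAt_const (0 : ℝ) (Iic 0) (0 : ℝ)).congr (fun y hy => ?_) (by simp [h0])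
      rcases eq_or_lt_of_le (mem_Iic.mp hy) with rfl | hy
      · simp [h0]
      · rw [if_neg hy.not_ge]
    have hr : HasDerivWithinAt (fun r => if 0 ≤ r then f r else 0) 0 (Ici 0) 0 := by
      have := (hf 0 le_rfl).hasDerivWithinAt (s := Ici 0)
      rw [h0'] at this
      exact this.congr (fun y hy => if_pos hy) (if_pos le_rfl)
    simpa using hl.union hr
  · rw [if_pos hr.le]
    refine (hf r hr.le).congr_of_eventuallyEq ?_
    filter_upwards [Ioi_mem_nhds hr] with y hy
    rw [if_pos (le_of_lt hy)]

/-- A `C²` convex function on the line vanishing on the negative axis, equal to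
`r³ / (1 + r)²` for `r ≥ 0`. -/
def ramp (r : ℝ) : ℝ := if 0 ≤ r then r ^ 3 / (1 + r) ^ 2 else 0

/-- The derivative of `ramp`. -/
def ramp' (r : ℝ) : ℝ := if 0 ≤ r then r ^ 2 * (r + 3) / (1 + r) ^ 3 else 0

/-- The second derivative of `ramp`. -/
def ramp'' (r : ℝ) : ℝ := if 0 ≤ r then 6 * r / (1 + r) ^ 4 else 0

theorem hasDerivAt_ramp (r : ℝ) : HasDerivAt ramp (ramp' r) r := by
  refine hasDerivAt_piecewise_zero (f := fun r => r ^ 3 / (1 + r) ^ 2)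
    (f' := fun r => r ^ 2 * (r + 3) / (1 + r) ^ 3) (fun r hr => ?_) (by simp) (by simp) r
  have hne : (1 + r) ≠ 0 := by positivity
  refine (((hasDerivAt_id r).pow 3).div (((hasDerivAt_id r).const_add 1).pow 2)
    (pow_ne_zero 2 hne)).congr_deriv ?_
  simp
  field_simp
  ring

theorem hasDerivAt_ramp' (r : ℝ) : HasDerivAt ramp' (ramp'' r) r := by
  refine hasDerivAt_piecewise_zero (f := fun r => r ^ 2 * (r + 3) / (1 + r) ^ 3)
    (f' := fun r => 6 * r / (1 + r) ^ 4) (fun r hr => ?_) (by simp) (by simp) r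
  have hne : (1 + r) ≠ 0 := by positivity
  refine ((((hasDerivAt_id r).pow 2).mul ((hasDerivAt_id r).add_const 3)).div
    (((hasDerivAt_id r).const_add 1).pow 3) (pow_ne_zero 3 hne)).congr_deriv ?_
  simp
  field_simp
  ring

theorem continuous_ramp'' : Continuous ramp'' := by
  have h : ramp'' = fun r => 6 * max r 0 / (1 + max r 0) ^ 4 := by
    funext r
    unfold ramp''
    split_ifs with hr
    · rw [max_eq_left hr]
    · rw [max_eq_right (not_le.mp hr).le]; simp
  rw [h]
  refine Continuous.div (by fun_prop) (by fun_prop) fun r => ?_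
  have : 0 ≤ max r 0 := le_max_right _ _
  positivity

theorem ramp_of_nonpos {r : ℝ} (hr : r ≤ 0) : ramp r = 0 ∧ ramp' r = 0 ∧ ramp'' r = 0 := by
  unfold ramp ramp' ramp''
  rcases hr.eq_or_lt with rfl | hr
  · simp
  · simp [hr.not_ge]

theorem ramp_bounds {r : ℝ} (hr : 0 ≤ r) :
    (0 ≤ ramp r ∧ ramp r ≤ 1 + r ∧ 1 + r ≤ ramp r + 3) ∧
    (0 ≤ (1 + r) * ramp' r - ramp r ∧ (1 + r) * ramp' r - ramp r ≤ 3) ∧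
    0 ≤ ramp'' r ∧ (1 + r) ^ 2 * ramp'' r ≤ 6 := by
  have h1 : (1 + r) * ramp' r - ramp r = 3 * r ^ 2 / (1 + r) ^ 2 := by
    simp only [ramp, ramp', if_pos hr]
    field_simp
    ring
  have h2 : (1 + r) ^ 2 * ramp'' r = 6 * r / (1 + r) ^ 2 := by
    simp only [ramp'', if_pos hr]
    field_simp
  rw [h1, h2]
  simp only [ramp, ramp'', if_pos hr]
  refine ⟨⟨by positivity, ?_, ?_⟩, ⟨by positivity, ?_⟩, by positivity, ?_⟩
  · rw [div_le_iff₀ (by positivity)]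
    nlinarith [pow_nonneg hr 2, pow_nonneg hr 3]
  · rw [← sub_le_iff_le_add, le_div_iff₀ (by positivity)]
    nlinarith [pow_nonneg hr 2, pow_nonneg hr 3]
  · rw [div_le_iff₀ (by positivity)]
    nlinarith
  · rw [div_le_iff₀ (by positivity)]
    nlinarith

/-- A `C²` convex approximation of `|·|` at scale `ε` vanishing near the origin. -/
theorem exists_convex_approx_abs {ε : ℝ} (hε : 0 < ε) :
    ∃ β β' β'' : ℝ → ℝ, (∀ s, HasDerivAt β (β' s) s) ∧ (∀ s, HasDerivAt β' (β'' s) s) ∧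
      Continuous β'' ∧ (∀ s, |s| ≤ ε → β s = 0 ∧ β' s = 0) ∧
      (∀ s, 0 ≤ β s ∧ β s ≤ |s| ∧ |s| ≤ β s + 3 * ε) ∧
      (∀ s, 0 ≤ s * β' s - β s ∧ s * β' s - β s ≤ 3 * ε) ∧
      ∀ s, 0 ≤ β'' s ∧ s ^ 2 * β'' s ≤ 6 * ε := by
  have key : ∀ s : ℝ, (0 ≤ ramp (s - 1) + ramp (-s - 1) ∧ ramp (s - 1) + ramp (-s - 1) ≤ |s| ∧
        |s| ≤ ramp (s - 1) + ramp (-s - 1) + 3) ∧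
      (0 ≤ s * (ramp' (s - 1) - ramp' (-s - 1)) - (ramp (s - 1) + ramp (-s - 1)) ∧
        s * (ramp' (s - 1) - ramp' (-s - 1)) - (ramp (s - 1) + ramp (-s - 1)) ≤ 3) ∧
      0 ≤ ramp'' (s - 1) + ramp'' (-s - 1) ∧
      s ^ 2 * (ramp'' (s - 1) + ramp'' (-s - 1)) ≤ 6 := by
    intro s
    rcases le_total s 0 with hs | hs
    · obtain ⟨e1, e2, e3⟩ := ramp_of_nonpos (r := s - 1) (by linarith)
      rw [e1, e2, e3, abs_of_nonpos hs]
      rcases le_total (-s - 1) 0 with h | h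
      · obtain ⟨e1, e2, e3⟩ := ramp_of_nonpos h
        rw [e1, e2, e3]
        norm_num
        exact ⟨hs, by linarith⟩
      · have := ramp_bounds h
        rw [show 1 + (-s - 1) = -s by ring] at this
        obtain ⟨⟨a1, a2, a3⟩, ⟨a4, a5⟩, a6, a7⟩ := this
        refine ⟨⟨?_, ?_, ?_⟩, ⟨?_, ?_⟩, ?_, ?_⟩ <;> linarith
    · obtain ⟨e1, e2, e3⟩ := ramp_of_nonpos (r := -s - 1) (by linarith)
      rw [e1, e2, e3, abs_of_nonneg hs]
      rcases le_total (s - 1) 0 with h | h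
      · obtain ⟨e1, e2, e3⟩ := ramp_of_nonpos h
        rw [e1, e2, e3]
        norm_num
        exact ⟨hs, by linarith⟩
      · have := ramp_bounds h
        rw [show 1 + (s - 1) = s by ring] at this
        obtain ⟨⟨a1, a2, a3⟩, ⟨a4, a5⟩, a6, a7⟩ := this
        refine ⟨⟨?_, ?_, ?_⟩, ⟨?_, ?_⟩, ?_, ?_⟩ <;> linarith
  have hsub : ∀ s : ℝ, HasDerivAt (fun s => s / ε - 1) (1 / ε) s := fun s =>
    ((hasDerivAt_id s).div_const ε).sub_const 1
  have hneg : ∀ s : ℝ, HasDerivAt (fun s => -(s / ε) - 1) (-(1 / ε)) s := fun s =>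
    ((hasDerivAt_id s).div_const ε).neg.sub_const 1
  refine ⟨fun s => ε * (ramp (s / ε - 1) + ramp (-(s / ε) - 1)),
    fun s => ramp' (s / ε - 1) - ramp' (-(s / ε) - 1),
    fun s => (ramp'' (s / ε - 1) + ramp'' (-(s / ε) - 1)) / ε, fun s => ?_, fun s => ?_, ?_,
    fun s hs => ?_, fun s => ?_, fun s => ?_, fun s => ?_⟩
  · refine ((((hasDerivAt_ramp _).comp s (hsub s)).add
      ((hasDerivAt_ramp _).comp s (hneg s))).const_mul ε).congr_deriv ?_
    field_simp
    ring
  · refine (((hasDerivAt_ramp' _).comp s (hsub s)).sub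
      ((hasDerivAt_ramp' _).comp s (hneg s))).congr_deriv ?_
    ring
  · have := continuous_ramp''
    fun_prop
  · have h1 : s / ε ≤ 1 := by rw [div_le_one hε]; exact (abs_le.mp hs).2
    have h2 : -(s / ε) ≤ 1 := by
      rw [← neg_div, div_le_one hε]; linarith [(abs_le.mp hs).1]
    obtain ⟨e1, e2, -⟩ := ramp_of_nonpos (r := s / ε - 1) (by linarith)
    obtain ⟨e3, e4, -⟩ := ramp_of_nonpos (r := -(s / ε) - 1) (by linarith)
    simp [e1, e2, e3, e4]
  · obtain ⟨⟨a1, a2, a3⟩, -⟩ := key (s / ε)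
    have hs : |s| = ε * |s / ε| := by rw [abs_div, abs_of_pos hε]; field_simp
    rw [hs]
    exact ⟨by positivity, mul_le_mul_of_nonneg_left a2 hε.le, by nlinarith⟩
  · obtain ⟨-, ⟨a4, a5⟩, -⟩ := key (s / ε)
    have hs : s * (ramp' (s / ε - 1) - ramp' (-(s / ε) - 1)) -
        ε * (ramp (s / ε - 1) + ramp (-(s / ε) - 1)) =
        ε * (s / ε * (ramp' (s / ε - 1) - ramp' (-(s / ε) - 1)) -
          (ramp (s / ε - 1) + ramp (-(s / ε) - 1))) := by field_simp
    simp only [hs]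
    exact ⟨by positivity, by nlinarith⟩
  · obtain ⟨-, -, a6, a7⟩ := key (s / ε)
    refine ⟨by positivity, ?_⟩
    have hs : s ^ 2 * ((ramp'' (s / ε - 1) + ramp'' (-(s / ε) - 1)) / ε) =
      ε * ((s / ε) ^ 2 * (ramp'' (s / ε - 1) + ramp'' (-(s / ε) - 1))) := by field_simp
    rw [hs]
    nlinarith

/-- The integral of a directional derivative of a function compactly supported in an open set. -/
theorem setIntegral_fderiv_eq_zero {E : Type*} [NormedAddCommGroup E] [NormedSpace ℝ E]
    [FiniteDimensional ℝ E] [MeasurableSpace E] [BorelSpace E] {μ : Measure E}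
    [μ.IsAddHaarMeasure] {D K : Set E} (hD : IsOpen D) (hK : IsCompact K) (hKD : K ⊆ D)
    {g g' : E → ℝ} {v : E} (hg : ∀ x ∈ D, ∃ L : E →L[ℝ] ℝ, HasFDerivAt g L x ∧ L v = g' x)
    (hg0 : ∀ x ∈ D, x ∉ K → g x = 0) (hint : IntegrableOn g' D μ) :
    ∫ x in D, g' x ∂μ = 0 := by
  have hfd : ∀ x, HasLineDerivAt ℝ (D.indicator g) (D.indicator g' x) x v := by
    intro x
    by_cases hx : x ∈ D
    · rw [indicator_of_mem hx]
      obtain ⟨L, hL, hLv⟩ := hg x hx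
      rw [← hLv]
      refine HasFDerivAt.hasLineDerivAt ?_ v
      refine hL.congr_of_eventuallyEq ?_
      filter_upwards [hD.mem_nhds hx] with y hy using indicator_of_mem hy g
    · rw [indicator_of_notMem hx]
      have h0 : HasFDerivAt (D.indicator g) (0 : E →L[ℝ] ℝ) x := by
        refine (hasFDerivAt_const (0 : ℝ) x).congr_of_eventuallyEq ?_
        filter_upwards [hK.isClosed.isOpen_compl.mem_nhds fun h => hx (hKD h)] with y hy
        by_cases hyD : y ∈ D
        · rw [indicator_of_mem hyD, hg0 y hyD hy]
        · rw [indicator_of_notMem hyD]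
      simpa using h0.hasLineDerivAt v
  have hgint : Integrable (D.indicator g) μ := by
    have h1 : D.indicator g = K.indicator g := by
      funext y
      by_cases hyK : y ∈ K
      · rw [indicator_of_mem hyK, indicator_of_mem (hKD hyK)]
      · rw [indicator_of_notMem hyK]
        by_cases hyD : y ∈ D
        · rw [indicator_of_mem hyD, hg0 y hyD hyK]
        · rw [indicator_of_notMem hyD]
    rw [h1, integrable_indicator_iff hK.measurableSet]
    exact ContinuousOn.integrableOn_compact hK
      fun x hx => (hg x (hKD hx)).choose_spec.1.continuousAt.continuousWithinAt
  have := integral_bilinear_hasLineDerivAt_right_eq_neg_left_of_integrable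
    (μ := μ) (B := ContinuousLinearMap.mul ℝ ℝ) (f := fun _ : E => (1 : ℝ)) (f' := fun _ => 0)
    (g := D.indicator g) (g' := D.indicator g') (v := v)
    (by simp) (by simpa using (integrable_indicator_iff hD.measurableSet).mpr hint)
    (by simpa using hgint)
    (fun x _ => by simpa using (hasFDerivAt_const (1 : ℝ) x).hasLineDerivAt v) fun x _ => hfd x
  simpa [integral_indicator hD.measurableSet] using this

theorem sum_mul_ebasis {d : ℕ} (f : Fin d → ℝ) (i : Fin d) :
    ∑ j, f j * ebasis d j i = f i := by
  simp [ebasis]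

/-- The `j`-th partial derivative of the `j`-th component of
`(κ - P) β'(u) (ν ∇u - u a) - ν β(u) ∇(κ - P)` when `∇P = l P eᵢ`, in terms of the values at a
point of `φ = κ - P`, of `P`, `β(u)`, `β'(u)`, `β''(u)`, `u`, `∂ⱼu`, `∂ⱼ∂ⱼu`, `aⱼ`, `∂ⱼaⱼ` and of
the Kronecker symbol `δ`. -/
def fluxDeriv (ν l φ P b b' b'' u du ddu a da δ : ℝ) : ℝ :=
  (-(l * P * δ) * b' + φ * (b'' * du)) * (ν * du - a * u) +
    φ * b' * (ν * ddu - (da * u + a * du)) -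
    ν * (b' * du * (-(l * P * δ)) + b * (-(l * (l * P * δ) * δ)))

theorem sub_sum_fluxDeriv_le {d : ℕ} {ν ρ l c ε φ P b b' b'' u : ℝ} (i : Fin d) (a : Euc d)
    (du ddu da : Fin d → ℝ) (hν : 0 < ν) (hρ : 0 ≤ ρ) (hl : 0 ≤ l) (hlc : ν * l = c + ρ)
    (hε : 0 ≤ ε) (hP : 0 ≤ P ∧ P ≤ 1) (hφ : 0 ≤ φ ∧ φ ≤ 2) (hb : 0 ≤ b)
    (hb' : 0 ≤ u * b' - b ∧ u * b' - b ≤ 3 * ε) (hb'' : 0 ≤ b'' ∧ u ^ 2 * b'' ≤ 6 * ε)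
    (ha : ‖a‖ ≤ ρ) :
    l * c * P * b + φ * b' * (ν * ∑ j, ddu j - ∑ j, (da j * u + a j * du j)) -
      ∑ j, fluxDeriv ν l φ P b b' b'' u (du j) (ddu j) (a j) (da j) (ebasis d j i) ≤
      (3 * l * ρ + 3 * ρ ^ 2 / ν) * ε := by
  have e1 : ∑ j, a j * ebasis d j i = a i := sum_mul_ebasis a i
  have e2 : ∑ j, ebasis d j i * ebasis d j i = 1 := by
    rw [sum_mul_ebasis (fun j => ebasis d j i) i]; simp [ebasis]
  have hsum : ∑ j, fluxDeriv ν l φ P b b' b'' u (du j) (ddu j) (a j) (da j) (ebasis d j i) =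
      l * P * b' * u * (∑ j, a j * ebasis d j i) +
      φ * b'' * (∑ j, (ν * du j ^ 2 - du j * a j * u)) +
      φ * b' * (ν * ∑ j, ddu j - ∑ j, (da j * u + a j * du j)) +
      ν * b * l ^ 2 * P * ∑ j, ebasis d j i * ebasis d j i := by
    simp only [Finset.mul_sum, ← Finset.sum_add_distrib, ← Finset.sum_sub_distrib]
    refine Finset.sum_congr rfl fun j _ => ?_
    unfold fluxDeriv
    ring
  rw [hsum, e1, e2]
  have hai : |a i| ≤ ρ := (PiLp.norm_apply_le a i).trans ha
  have hsq : ∑ j, a j ^ 2 ≤ ρ ^ 2 := by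
    have := EuclideanSpace.real_norm_sq_eq a
    rw [← this]
    gcongr
  have hq : -(u ^ 2 * ρ ^ 2 / (4 * ν)) ≤ ∑ j, (ν * du j ^ 2 - du j * a j * u) := by
    calc -(u ^ 2 * ρ ^ 2 / (4 * ν)) ≤ -(u ^ 2 * (∑ j, a j ^ 2) / (4 * ν)) := by gcongr
      _ = ∑ j, -(u ^ 2 * a j ^ 2 / (4 * ν)) := by
        rw [Finset.mul_sum, Finset.sum_div, Finset.sum_neg_distrib]
      _ ≤ _ := by
        refine Finset.sum_le_sum fun j _ => ?_
        rw [neg_le_iff_add_nonneg]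
        have : ν * du j ^ 2 - du j * a j * u + u ^ 2 * a j ^ 2 / (4 * ν) =
          (2 * ν * du j - a j * u) ^ 2 / (4 * ν) := by field_simp; ring
        rw [this]
        positivity
  have h1 : -(φ * b'' * (∑ j, (ν * du j ^ 2 - du j * a j * u))) ≤ 3 * ρ ^ 2 / ν * ε := by
    have h2 := mul_le_mul_of_nonneg_left hq (mul_nonneg hφ.1 hb''.1)
    have h3 : φ * (u ^ 2 * b'') ≤ 2 * (6 * ε) :=
      mul_le_mul hφ.2 hb''.2 (mul_nonneg (sq_nonneg u) hb''.1) (by norm_num)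
    have h4 : φ * b'' * (u ^ 2 * ρ ^ 2 / (4 * ν)) = φ * (u ^ 2 * b'') * (ρ ^ 2 / (4 * ν)) := by ring
    have h5 : 3 * ρ ^ 2 / ν * ε = 2 * (6 * ε) * (ρ ^ 2 / (4 * ν)) := by field_simp; ring
    have h6 : φ * (u ^ 2 * b'') * (ρ ^ 2 / (4 * ν)) ≤ 2 * (6 * ε) * (ρ ^ 2 / (4 * ν)) := by gcongr
    linarith
  have h2 : l * c * P * b - l * P * b' * u * a i - ν * b * l ^ 2 * P * 1 ≤ 3 * l * ρ * ε := by
    have e : l * c * P * b - l * P * b' * u * a i - ν * b * l ^ 2 * P * 1 =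
        l * P * (-((ρ + a i) * b) - a i * (u * b' - b)) := by
      have : ν * b * l ^ 2 * P = b * l * P * (ν * l) := by ring
      rw [this, hlc]; ring
    have h3 : 0 ≤ (ρ + a i) * b := mul_nonneg (by linarith [(abs_le.mp hai).1]) hb
    have h4 : -(a i * (u * b' - b)) ≤ ρ * (3 * ε) := by
      rw [← neg_mul]
      calc -a i * (u * b' - b) ≤ ρ * (u * b' - b) :=
            mul_le_mul_of_nonneg_right (by linarith [(abs_le.mp hai).1]) hb'.1
        _ ≤ _ := by gcongr; exact hb'.2
    rw [e]
    calc l * P * (-((ρ + a i) * b) - a i * (u * b' - b)) ≤ l * P * (ρ * (3 * ε)) := by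
          gcongr; exacts [mul_nonneg hl hP.1, by linarith]
      _ ≤ l * 1 * (ρ * (3 * ε)) := by gcongr; exact hP.2
      _ = _ := by ring
  linarith

/-- The divergence of the flux field is continuous up to the boundary. -/
theorem continuousOn_fluxDeriv {d : ℕ} {S : Set (Euc d)} {κ ν l : ℝ} {P : Euc d → ℝ}
    {i j : Fin d} (hP : Continuous P)
    {β β' β'' : ℝ → ℝ} (hβ : Continuous β) (hβ' : Continuous β') (hβ'' : Continuous β'')
    {u : Euc d → ℝ} {a : Euc d → Euc d} (hu : ContinuousOn u S)
    (hdu : ContinuousOn (dx1 u) S) (hddu : ContinuousOn (dx2 u) S)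
    (ha : ContinuousOn a S) (hda : ContinuousOn (fderiv ℝ a) S) :
    ContinuousOn (fun x => fluxDeriv ν l (κ - P x) (P x) (β (u x)) (β' (u x)) (β'' (u x)) (u x)
      (dx1 u x (ebasis d j)) (dx2 u x (ebasis d j) (ebasis d j)) (a x j)
      (fderiv ℝ a x (ebasis d j) j) (ebasis d j i)) S := by
  have h1 := hβ.comp_continuousOn hu
  have h2 := hβ'.comp_continuousOn hu
  have h3 := hβ''.comp_continuousOn hu
  have h4 : ContinuousOn (fun x => dx1 u x (ebasis d j)) S := hdu.clm_apply continuousOn_const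
  have h5 : ContinuousOn (fun x => dx2 u x (ebasis d j) (ebasis d j)) S :=
    (hddu.clm_apply continuousOn_const).clm_apply continuousOn_const
  have h6 : ContinuousOn (fun x => a x j) S := (EuclideanSpace.proj j).continuous.comp_continuousOn ha
  have h7 : ContinuousOn (fun x => fderiv ℝ a x (ebasis d j) j) S :=
    (EuclideanSpace.proj (𝕜 := ℝ) j).continuous.comp_continuousOn
      (hda.clm_apply continuousOn_const)
  have h8 : ContinuousOn P S := hP.continuousOn
  unfold fluxDeriv
  simp only [Function.comp_def] at h1 h2 h3
  fun_prop

theorem setIntegral_fluxDeriv_eq_zero {d : ℕ} {D : Set (Euc d)} (hD : IsOpen D)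
    (hDb : Bornology.IsBounded D) {κ ν l ε : ℝ} {P : Euc d → ℝ} {i : Fin d} (j : Fin d)
    (hε : 0 < ε) (hP : ∀ x, HasFDerivAt P ((l * P x) • EuclideanSpace.proj (𝕜 := ℝ) i) x)
    {β β' β'' : ℝ → ℝ} (hβ : ∀ s, HasDerivAt β (β' s) s) (hβ' : ∀ s, HasDerivAt β' (β'' s) s)
    (hβ'' : Continuous β'') (hβ0 : ∀ s, |s| ≤ ε → β s = 0 ∧ β' s = 0)
    {u : Euc d → ℝ} {a : Euc d → Euc d} (hu : ContinuousOn u (closure D))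
    (hu0 : ∀ x ∈ frontier D, u x = 0)
    (hud : ∀ x ∈ closure D, DifferentiableAt ℝ u x)
    (hudd : ∀ x ∈ closure D, DifferentiableAt ℝ (fun y => fderiv ℝ u y) x)
    (hdu : ContinuousOn (dx1 u) (closure D)) (hddu : ContinuousOn (dx2 u) (closure D))
    (ha : ContinuousOn a (closure D)) (had : ∀ x ∈ closure D, DifferentiableAt ℝ a x)
    (hda : ContinuousOn (fderiv ℝ a) (closure D)) :
    IntegrableOn (fun x => fluxDeriv ν l (κ - P x) (P x) (β (u x)) (β' (u x)) (β'' (u x)) (u x)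
      (dx1 u x (ebasis d j)) (dx2 u x (ebasis d j) (ebasis d j)) (a x j)
      (fderiv ℝ a x (ebasis d j) j) (ebasis d j i)) D ∧
    ∫ x in D, fluxDeriv ν l (κ - P x) (P x) (β (u x)) (β' (u x)) (β'' (u x)) (u x)
      (dx1 u x (ebasis d j)) (dx2 u x (ebasis d j) (ebasis d j)) (a x j)
      (fderiv ℝ a x (ebasis d j) j) (ebasis d j i) = 0 := by
  have hDc : IsCompact (closure D) := hDb.isCompact_closure
  have hint := ((continuousOn_fluxDeriv (κ := κ) (ν := ν) (l := l) (i := i) (j := j)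
    (continuous_iff_continuousAt.mpr fun x => (hP x).continuousAt)
    (continuous_iff_continuousAt.mpr fun s => (hβ s).continuousAt)
    (continuous_iff_continuousAt.mpr fun s => (hβ' s).continuousAt) hβ'' hu hdu hddu ha
    hda).integrableOn_compact hDc (μ := volume)).mono_set subset_closure
  refine ⟨hint, ?_⟩
  have hK : IsCompact (closure D ∩ u ⁻¹' {s | ε ≤ |s|}) :=
    hDc.of_isClosed_subset (hu.preimage_isClosed_of_isClosed hDc.isClosed
      (isClosed_le continuous_const continuous_abs)) inter_subset_left
  refine setIntegral_fderiv_eq_zero (v := ebasis d j)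
    (g := fun x => (κ - P x) * β' (u x) * (ν * fderiv ℝ u x (ebasis d j) - a x j * u x) -
      ν * (β (u x) * (-(l * P x * ebasis d j i)))) hD hK ?_ ?_ ?_ hint
  · rintro x ⟨hx, hxu⟩
    by_contra hxD
    have := hu0 x (by rw [frontier, hD.interior_eq]; exact ⟨hx, hxD⟩)
    simp only [mem_preimage, mem_ofPred_eq, this, abs_zero] at hxu
    linarith
  · intro x hxD
    have hx := subset_closure hxD
    have hu1 := (hud x hx).hasFDerivAt
    have hu2 : HasFDerivAt (fun y => fderiv ℝ u y (ebasis d j))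
        ((dx2 u x).flip (ebasis d j)) x := by
      simpa [dx2] using (hudd x hx).hasFDerivAt.clm_apply (hasFDerivAt_const (ebasis d j) x)
    have ha1 : HasFDerivAt (fun y => a y j)
        ((EuclideanSpace.proj (𝕜 := ℝ) j).comp (fderiv ℝ a x)) x :=
      (EuclideanSpace.proj (𝕜 := ℝ) j).hasFDerivAt.comp x (had x hx).hasFDerivAt
    have hb1 := (hβ (u x)).comp_hasFDerivAt x hu1
    have hb2 := (hβ' (u x)).comp_hasFDerivAt x hu1
    refine ⟨_, ((((hP x).const_sub κ).mul hb2).mul ((hu2.const_mul ν).sub (ha1.mul hu1))).sub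
      ((hb1.mul (((hP x).const_mul l).mul_const (ebasis d j i)).neg).const_mul ν), ?_⟩
    simp only [fluxDeriv, dx1]
    simp
    ring
  · intro x hxD hxK
    have : |u x| ≤ ε := by
      by_contra h
      exact hxK ⟨subset_closure hxD, (not_le.mp h).le⟩
    obtain ⟨h1, h2⟩ := hβ0 _ this
    simp [h1, h2]

theorem divAW_eq {d : ℕ} {a : ℝ → Euc d → Euc d} {w : ℝ → Euc d → ℝ} {t : ℝ} {x : Euc d}
    (ha : DifferentiableAt ℝ (a t) x) (hw : DifferentiableAt ℝ (w t) x) :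
    divAW a w t x = ∑ j, (fderiv ℝ (a t) x (ebasis d j) j * w t x +
      a t x j * dx1 (w t) x (ebasis d j)) := by
  refine Finset.sum_congr rfl fun j _ => ?_
  have ha1 : HasFDerivAt (fun y => a t y j)
      ((EuclideanSpace.proj (𝕜 := ℝ) j).comp (fderiv ℝ (a t) x)) x :=
    (EuclideanSpace.proj (𝕜 := ℝ) j).hasFDerivAt.comp x ha.hasFDerivAt
  rw [show (fun y => a t y j * w t y) = (fun y => a t y j) * w t from rfl,
    (ha1.mul hw.hasFDerivAt).fderiv]
  simp [dx1]
  ring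

/-- The travelling exponential used as a barrier. -/
def travellingExp {d : ℕ} (i : Fin d) (l c R t : ℝ) (x : Euc d) : ℝ :=
  Real.exp (l * (x i - R - c * t))

theorem continuous_travellingExp {d : ℕ} (i : Fin d) (l c R : ℝ) :
    Continuous fun p : ℝ × Euc d => travellingExp i l c R p.1 p.2 := by
  unfold travellingExp
  have : Continuous fun p : ℝ × Euc d => p.2 i :=
    (EuclideanSpace.proj (𝕜 := ℝ) i).continuous.comp continuous_snd
  fun_prop

theorem hasFDerivAt_travellingExp {d : ℕ} (i : Fin d) (l c R t : ℝ) (x : Euc d) :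
    HasFDerivAt (travellingExp i l c R t)
      ((l * travellingExp i l c R t x) • EuclideanSpace.proj (𝕜 := ℝ) i) x := by
  have h : HasFDerivAt (fun y : Euc d => y i) (EuclideanSpace.proj (𝕜 := ℝ) i) x :=
    (EuclideanSpace.proj (𝕜 := ℝ) i).hasFDerivAt
  refine (((h.sub_const R).sub_const (c * t)).const_mul l).exp.congr_fderiv ?_
  rw [smul_smul, mul_comm]
  rfl

theorem hasDerivAt_travellingExp {d : ℕ} (i : Fin d) (l c R t : ℝ) (x : Euc d) :
    HasDerivAt (fun s => travellingExp i l c R s x) (-(l * c * travellingExp i l c R t x)) t := by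
  have h := ((((hasDerivAt_id t).const_mul c).const_sub (x i - R)).const_mul l).exp
  refine h.congr_deriv ?_
  simp only [travellingExp, id]
  ring

section Decay

variable {d : ℕ} {D : Set (Euc d)} {ν T ρ l c R κ ε : ℝ} {i : Fin d}
  {β β' β'' : ℝ → ℝ} {a : ℝ → Euc d → Euc d} {w : ℝ → Euc d → ℝ}

/-- The time derivative of the weighted integral of `β(w)` is of order `ε`. -/
theorem setIntegral_deriv_weighted_le (hD : IsOpen D) (hDb : Bornology.IsBounded D)
    (hν : 0 < ν) (hρ : 0 < ρ) (hl : 0 ≤ l) (hc : 0 ≤ c) (hlc : ν * l = c + ρ)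
    (hR : ∀ x ∈ D, x i ≤ R) (hκ : 1 ≤ κ ∧ κ ≤ 2) (hε : 0 < ε)
    (hβ : ∀ s, HasDerivAt β (β' s) s) (hβ' : ∀ s, HasDerivAt β' (β'' s) s)
    (hβ'' : Continuous β'') (hβ0 : ∀ s, |s| ≤ ε → β s = 0 ∧ β' s = 0) (hβpos : ∀ s, 0 ≤ β s)
    (hββ : ∀ s, 0 ≤ s * β' s - β s ∧ s * β' s - β s ≤ 3 * ε)
    (hβ2 : ∀ s, 0 ≤ β'' s ∧ s ^ 2 * β'' s ≤ 6 * ε)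
    (ha : ContinuousOn (fun p : ℝ × Euc d => a p.1 p.2) (Icc 0 T ×ˢ closure D))
    (had : ∀ t ∈ Icc (0:ℝ) T, ∀ x ∈ closure D, DifferentiableAt ℝ (a t) x)
    (hda : ContinuousOn (fun p : ℝ × Euc d => fderiv ℝ (a p.1) p.2) (Icc 0 T ×ˢ closure D))
    (haρ : ∀ t ∈ Icc (0:ℝ) T, ∀ x ∈ D, ‖a t x‖ + ‖fderiv ℝ (a t) x‖ ≤ ρ)
    (hw : IsC12On (Icc 0 T) D w)
    (hpde : ∀ t ∈ Icc (0:ℝ) T, ∀ x ∈ D, dtt w t x - ν * lapl (w t) x + divAW a w t x = 0)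
    (hbc : DirichletBC (Icc 0 T) D w) {t : ℝ} (ht : t ∈ Icc 0 T)
    (hint : IntegrableOn (fun x => l * c * travellingExp i l c R t x * β (w t x) +
      (κ - travellingExp i l c R t x) * (β' (w t x) * dtt w t x)) D) :
    ∫ x in D, (l * c * travellingExp i l c R t x * β (w t x) +
      (κ - travellingExp i l c R t x) * (β' (w t x) * dtt w t x)) ≤
      (3 * l * ρ + 3 * ρ ^ 2 / ν) * ε * volume.real D := by
  obtain ⟨hw0, -, hwd, hwdd, -, hw1, hw2⟩ := hw
  have slice : ∀ {Y : Type} [TopologicalSpace Y] (f : ℝ × Euc d → Y),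
      ContinuousOn f (Icc 0 T ×ˢ closure D) → ContinuousOn (fun x => f (t, x)) (closure D) :=
    fun f hf => hf.comp (by fun_prop) fun x hx => ⟨ht, hx⟩
  have hflux := fun j => setIntegral_fluxDeriv_eq_zero (κ := κ) (ν := ν) hD hDb j hε
    (hasFDerivAt_travellingExp i l c R t) hβ hβ' hβ'' hβ0 (slice _ hw0) (hbc t ht) (hwd t ht)
    (hwdd t ht) (slice _ hw1) (slice _ hw2) (slice _ ha) (had t ht) (slice _ hda)
  have hzero := integral_finsetSum (μ := volume.restrict D) Finset.univ
    fun j _ => (hflux j).1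
  rw [Finset.sum_eq_zero fun j _ => (hflux j).2] at hzero
  have hfint := integrable_finsetSum (μ := volume.restrict D) Finset.univ
    fun j _ => (hflux j).1
  rw [← sub_zero (∫ x in D, _), ← hzero, ← integral_sub hint hfint]
  have hfin : volume D ≠ ⊤ := hDb.measure_lt_top.ne
  have hle := setIntegral_mono_on (hint.sub hfint)
    (integrableOn_const (C := (3 * l * ρ + 3 * ρ ^ 2 / ν) * ε) hfin) hD.measurableSet
    fun x hx => ?_
  · refine hle.trans_eq ?_
    rw [setIntegral_const, smul_eq_mul, mul_comm]
  · have hxc := subset_closure hx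
    have hP0 : 0 ≤ travellingExp i l c R t x := (Real.exp_pos _).le
    have hP1 : travellingExp i l c R t x ≤ 1 := by
      refine Real.exp_le_one_iff.mpr (mul_nonpos_of_nonneg_of_nonpos hl ?_)
      linarith [hR x hx, mul_nonneg hc ht.1]
    have hwt : dtt w t x = ν * ∑ j, dx2 (w t) x (ebasis d j) (ebasis d j) -
        ∑ j, (fderiv ℝ (a t) x (ebasis d j) j * w t x + a t x j * dx1 (w t) x (ebasis d j)) := by
      have := hpde t ht x hx
      rw [divAW_eq (had t ht x hxc) (hwd t ht x hxc), lapl] at this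
      linarith
    have := sub_sum_fluxDeriv_le (φ := κ - travellingExp i l c R t x) i (a t x)
      (fun j => dx1 (w t) x (ebasis d j)) (fun j => dx2 (w t) x (ebasis d j) (ebasis d j))
      (fun j => fderiv ℝ (a t) x (ebasis d j) j) hν hρ.le hl hlc hε.le ⟨hP0, hP1⟩
      ⟨by linarith [hκ.1], by linarith [hκ.2]⟩ (hβpos (w t x)) (hββ (w t x)) (hβ2 (w t x))
      (by linarith [haρ t ht x hx, norm_nonneg (fderiv ℝ (a t) x)])
    rw [← hwt, mul_assoc (κ - _)] at this
    exact this

/-- Weighted `L¹` estimate, up to an error of order `ε`. -/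
theorem weighted_integral_le (hD : IsOpen D) (hDb : Bornology.IsBounded D)
    (hν : 0 < ν) (hT : 0 < T) (hρ : 0 < ρ) (hl : 0 ≤ l) (hc : 0 ≤ c) (hlc : ν * l = c + ρ)
    (hR : ∀ x ∈ D, |x i| ≤ R) (hcT : c * T = 2 * R + 1)
    (hε : 0 < ε)
    (ha : ContinuousOn (fun p : ℝ × Euc d => a p.1 p.2) (Icc 0 T ×ˢ closure D))
    (had : ∀ t ∈ Icc (0:ℝ) T, ∀ x ∈ closure D, DifferentiableAt ℝ (a t) x)
    (hda : ContinuousOn (fun p : ℝ × Euc d => fderiv ℝ (a p.1) p.2) (Icc 0 T ×ˢ closure D))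
    (haρ : ∀ t ∈ Icc (0:ℝ) T, ∀ x ∈ D, ‖a t x‖ + ‖fderiv ℝ (a t) x‖ ≤ ρ)
    (hw : IsC12On (Icc 0 T) D w)
    (hpde : ∀ t ∈ Icc (0:ℝ) T, ∀ x ∈ D, dtt w t x - ν * lapl (w t) x + divAW a w t x = 0)
    (hbc : DirichletBC (Icc 0 T) D w) :
    L1norm D (w T) ≤
      (1 + Real.exp (-(l * (2 * R + 1))) - Real.exp (-(l * (2 * R)))) * L1norm D (w 0) +
      (T * (3 * l * ρ + 3 * ρ ^ 2 / ν) + 3) * volume.real D * ε := by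
  obtain ⟨β, β', β'', hβ, hβ', hβ'', hβ0, hβb, hββ, hβ2⟩ := exists_convex_approx_abs hε
  have hw' := hw
  obtain ⟨hw0, hwt, -, -, hdt, -, -⟩ := hw'
  have hfin : volume D ≠ ⊤ := hDb.measure_lt_top.ne
  have hDc : IsCompact (closure D) := hDb.isCompact_closure
  have hβc : Continuous β := continuous_iff_continuousAt.mpr fun s => (hβ s).continuousAt
  have hβc' : Continuous β' := continuous_iff_continuousAt.mpr fun s => (hβ' s).continuousAt
  set κ : ℝ := 1 + Real.exp (-(l * (2 * R + 1))) with hκ_def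
  set P := travellingExp i l c R with hP_def
  have hPc : Continuous fun p : ℝ × Euc d => P p.1 p.2 := continuous_travellingExp i l c R
  set Φ : ℝ → Euc d → ℝ := fun t x => (κ - P t x) * β (w t x) with hΦ_def
  set Ψ : ℝ → Euc d → ℝ := fun t x =>
    l * c * P t x * β (w t x) + (κ - P t x) * (β' (w t x) * dtt w t x) with hΨ_def
  have hR0 : ∀ x ∈ D, 0 ≤ R := fun x hx => (abs_nonneg _).trans (hR x hx)
  have hcT0 : 0 ≤ 2 * R + 1 := hcT ▸ mul_nonneg hc hT.le
  have hκ : 1 ≤ κ ∧ κ ≤ 2 := by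
    refine ⟨by linarith [Real.exp_pos (-(l * (2 * R + 1)))], ?_⟩
    have : Real.exp (-(l * (2 * R + 1))) ≤ 1 :=
      Real.exp_le_one_iff.mpr (neg_nonpos.mpr (mul_nonneg hl hcT0))
    linarith
  have hΦc : ContinuousOn (fun p : ℝ × Euc d => Φ p.1 p.2) (Icc 0 T ×ˢ closure D) :=
    (continuous_const.sub hPc).continuousOn.mul (hβc.comp_continuousOn hw0)
  have hΨc : ContinuousOn (fun p : ℝ × Euc d => Ψ p.1 p.2) (Icc 0 T ×ˢ closure D) :=
    ((continuous_const.mul hPc).continuousOn.mul (hβc.comp_continuousOn hw0)).add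
      ((continuous_const.sub hPc).continuousOn.mul ((hβc'.comp_continuousOn hw0).mul hdt))
  have slice : ∀ (f : ℝ → Euc d → ℝ) (t : ℝ), t ∈ Icc 0 T →
      ContinuousOn (fun p : ℝ × Euc d => f p.1 p.2) (Icc 0 T ×ˢ closure D) →
      IntegrableOn (f t) D := fun f t ht hf =>
    ((hf.comp (f := fun x => (t, x)) (by fun_prop) fun x hx =>
      ⟨ht, hx⟩).integrableOn_compact hDc).mono_set subset_closure
  have h0 : (0 : ℝ) ∈ Icc 0 T := ⟨le_rfl, hT.le⟩
  have h1 : T ∈ Icc 0 T := ⟨hT.le, le_rfl⟩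
  have hslice : ∀ t ∈ Icc 0 T, ∫ x in D, Ψ t x ≤
      (3 * l * ρ + 3 * ρ ^ 2 / ν) * ε * volume.real D := fun t ht =>
    setIntegral_deriv_weighted_le hD hDb hν hρ hl hc hlc (fun x hx => (abs_le.mp (hR x hx)).2) hκ
      hε hβ hβ' hβ'' hβ0 (fun s => (hβb s).1) hββ hβ2 ha had hda haρ hw hpde hbc ht
      (slice Ψ t ht hΨc)
  have hftc : ∀ x ∈ D, ∫ t in 0..T, Ψ t x = Φ T x - Φ 0 x := by
    intro x hx
    have hxc := subset_closure hx
    refine intervalIntegral.integral_eq_sub_of_hasDerivAt (f := fun t => Φ t x) ?_ ?_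
    · intro t ht
      rw [uIcc_of_le hT.le] at ht
      refine (((hasDerivAt_travellingExp i l c R t x).const_sub κ).mul
        ((hβ (w t x)).comp t (hwt x hxc t ht).hasDerivAt)).congr_deriv ?_
      simp only [hΨ_def, dtt, hP_def]
      simp
    · refine ContinuousOn.intervalIntegrable ?_
      rw [uIcc_of_le hT.le]
      exact hΨc.comp (f := fun t => (t, x)) (by fun_prop) fun t ht => ⟨ht, hxc⟩
  have hprod : Integrable (Function.uncurry Ψ)
      ((volume.restrict (uIoc 0 T)).prod (volume.restrict D)) := by
    rw [Measure.prod_restrict]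
    have := hΨc.integrableOn_compact (μ := (volume : Measure ℝ).prod (volume : Measure (Euc d)))
      (isCompact_Icc.prod hDc)
    refine this.mono_set (prod_mono ?_ subset_closure)
    rw [uIoc_of_le hT.le]
    exact Ioc_subset_Icc_self
  have hswap := intervalIntegral_integral_swap hprod
  have htotal : ∫ x in D, (Φ T x - Φ 0 x) ≤
      T * ((3 * l * ρ + 3 * ρ ^ 2 / ν) * ε * volume.real D) := by
    rw [← setIntegral_congr_fun hD.measurableSet hftc, ← hswap]
    have hii : IntervalIntegrable (fun t => ∫ x in D, Ψ t x) volume 0 T :=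
      intervalIntegrable_iff.mpr hprod.integral_prod_left
    refine (intervalIntegral.integral_mono_on hT.le hii intervalIntegrable_const
      hslice).trans_eq ?_
    rw [intervalIntegral.integral_const, sub_zero, smul_eq_mul]
  rw [integral_sub (slice Φ T h1 hΦc) (slice Φ 0 h0 hΦc)] at htotal
  have hwabs : ∀ t ∈ Icc 0 T, IntegrableOn (fun x => |w t x|) D := fun t ht =>
    slice (fun t x => |w t x|) t ht hw0.abs
  have hlow : L1norm D (w T) - 3 * ε * volume.real D ≤ ∫ x in D, Φ T x := by
    have hc3 : IntegrableOn (fun _ : Euc d => 3 * ε) D := integrableOn_const hfin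
    have : L1norm D (w T) - 3 * ε * volume.real D = ∫ x in D, (|w T x| - 3 * ε) := by
      rw [integral_sub (hwabs T h1) hc3, setIntegral_const, smul_eq_mul, mul_comm (volume.real D)]
      rfl
    rw [this]
    refine setIntegral_mono_on ((hwabs T h1).sub hc3) (slice Φ T h1 hΦc) hD.measurableSet
      fun x hx => ?_
    have hP : P T x ≤ Real.exp (-(l * (2 * R + 1))) := by
      refine Real.exp_le_exp.mpr ?_
      rw [hcT, ← mul_neg]
      exact mul_le_mul_of_nonneg_left (by linarith [(abs_le.mp (hR x hx)).2]) hl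
    have := mul_le_mul_of_nonneg_right (show 1 ≤ κ - P T x by linarith) (hβb (w T x)).1
    simp only [hΦ_def]
    linarith [(hβb (w T x)).2.2]
  have hup : ∫ x in D, Φ 0 x ≤ (κ - Real.exp (-(l * (2 * R)))) * L1norm D (w 0) := by
    rw [L1norm, ← integral_const_mul]
    refine setIntegral_mono_on (slice Φ 0 h0 hΦc) ((hwabs 0 h0).const_mul _) hD.measurableSet
      fun x hx => ?_
    have hP : Real.exp (-(l * (2 * R))) ≤ P 0 x := by
      refine Real.exp_le_exp.mpr ?_
      rw [← mul_neg]
      exact mul_le_mul_of_nonneg_left (by linarith [(abs_le.mp (hR x hx)).1]) hl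
    have hle : Real.exp (-(l * (2 * R))) ≤ 1 :=
      Real.exp_le_one_iff.mpr (neg_nonpos.mpr (mul_nonneg hl (by linarith [hR0 x hx])))
    exact mul_le_mul (by linarith) (hβb (w 0 x)).2.1 (hβb (w 0 x)).1 (by linarith [hκ.1])
  linarith

end Decay

/-- In positive dimension the Dirichlet condition forces the `L¹` norm to decay by a fixed factor. -/
theorem exists_L1norm_le_mul {d : ℕ} {D : Set (Euc d)} (hD : IsOpen D)
    (hDb : Bornology.IsBounded D) (i : Fin d) {ν T ρ : ℝ} (hν : 0 < ν) (hT : 0 < T)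
    (hρ : 0 < ρ) :
    ∃ q < 1, ∀ a : ℝ → Euc d → Euc d,
      ContinuousOn (fun p : ℝ × Euc d => a p.1 p.2) (Icc 0 T ×ˢ closure D) →
      (∀ t ∈ Icc (0:ℝ) T, ∀ x ∈ closure D, DifferentiableAt ℝ (a t) x) →
      ContinuousOn (fun p : ℝ × Euc d => fderiv ℝ (a p.1) p.2) (Icc 0 T ×ˢ closure D) →
      (∀ t ∈ Icc (0:ℝ) T, ∀ x ∈ D, ‖a t x‖ + ‖fderiv ℝ (a t) x‖ ≤ ρ) →
      ∀ w : ℝ → Euc d → ℝ, IsC12On (Icc 0 T) D w →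
        (∀ t ∈ Icc (0:ℝ) T, ∀ x ∈ D, dtt w t x - ν * lapl (w t) x + divAW a w t x = 0) →
        DirichletBC (Icc 0 T) D w → L1norm D (w T) ≤ q * L1norm D (w 0) := by
  obtain ⟨R, hRpos, hR⟩ := hDb.exists_pos_norm_le
  obtain ⟨c, hc⟩ : ∃ c, c = (2 * R + 1) / T := ⟨_, rfl⟩
  obtain ⟨l, hl⟩ : ∃ l, l = (c + ρ) / ν := ⟨_, rfl⟩
  have hc0 : 0 < c := by rw [hc]; positivity
  have hl0 : 0 < l := by rw [hl]; positivity
  refine ⟨1 + Real.exp (-(l * (2 * R + 1))) - Real.exp (-(l * (2 * R))), ?_, ?_⟩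
  · have : Real.exp (-(l * (2 * R + 1))) < Real.exp (-(l * (2 * R))) :=
      Real.exp_lt_exp.mpr (by linarith)
    linarith
  · intro a ha had hda haρ w hw hpde hbc
    refine le_of_forall_pos_le_add fun η hη => ?_
    set C := (T * (3 * l * ρ + 3 * ρ ^ 2 / ν) + 3) * volume.real D with hC
    have hC0 : 0 ≤ C := by positivity
    have := weighted_integral_le (ε := η / (C + 1)) (i := i) hD hDb hν hT hρ hl0.le hc0.le
      (by rw [hl]; field_simp) (fun x hx => (PiLp.norm_apply_le x i).trans (hR x hx))
      (by rw [hc]; field_simp) (by positivity) ha had hda haρ hw hpde hbc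
    refine this.trans ?_
    have : C * (η / (C + 1)) ≤ η := by
      rw [mul_div_assoc', div_le_iff₀ (by positivity)]
      nlinarith
    linarith

/-- In dimension zero the solutions are constant in time. -/
theorem L1norm_le_abs_of_dim_zero {D : Set (Euc 0)} {ν T : ℝ} (hT : 0 < T)
    {a : ℝ → Euc 0 → Euc 0} {w : ℝ → Euc 0 → ℝ} (hw : IsC12On (Icc 0 T) D w)
    (hpde : ∀ t ∈ Icc (0:ℝ) T, ∀ x ∈ D, dtt w t x - ν * lapl (w t) x + divAW a w t x = 0)
    {x : Euc 0} (hx : x ∈ D) : L1norm D (w 0) ≤ |w T x| := by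
  have hDu : D = univ := eq_univ_of_forall fun y => Subsingleton.elim x y ▸ hx
  have hconst : w T x = w 0 x := by
    have hd : ∀ t ∈ Icc 0 T, HasDerivAt (fun s => w s x) 0 t := fun t ht => by
      have h := hpde t ht x hx
      have hz : dtt w t x = 0 := by simpa [lapl, divAW] using h
      exact hz ▸ (hw.2.1 x (subset_closure hx) t ht).hasDerivAt
    exact constant_of_has_deriv_right_zero (f := fun s => w s x)
      (fun t ht => (hd t ht).continuousAt.continuousWithinAt)
      (fun t ht => (hd t (Ico_subset_Icc_self ht)).hasDerivWithinAt) T ⟨hT.le, le_rfl⟩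
  have hvol : (volume : Measure (Euc 0)) = Measure.dirac x := by
    rw [Subsingleton.elim x 0, volume_euclideanSpace_eq_dirac]
  rw [L1norm, hDu, Measure.restrict_univ, hvol, integral_dirac, hconst]

/-- Proposition 2.3, dichotomy: for solutions of the linear problem
`∂ₜw - νΔw + div(a w) = 0`, either the `L¹` norm squeezes by a factor `q < 1`, or `|w(T,·)|`
is minorised on `Π` by `δ ‖w(0,·)‖_{L¹}`, with `q, δ` depending only on `T, ρ, ν, Π, D`. -/
theorem stmt_9 {d : ℕ} (D Pia : Set (Euc d)) (hD : GoodDomain D)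
    (hP : IsOpen Pia ∧ closure Pia ⊆ D)
    (ν T ρ : ℝ) (hν : 0 < ν) (hT : 0 < T) (hρ : 0 < ρ) :
    ∃ q δ : ℝ, q < 1 ∧ 0 < δ ∧
      ∀ a : ℝ → Euc d → Euc d,
        ContinuousOn (fun p : ℝ × Euc d => a p.1 p.2) (Icc 0 T ×ˢ closure D) →
        (∀ t ∈ Icc (0:ℝ) T, ∀ x ∈ closure D, DifferentiableAt ℝ (a t) x) →
        ContinuousOn (fun p : ℝ × Euc d => fderiv ℝ (a p.1) p.2) (Icc 0 T ×ˢ closure D) →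
        (∀ t ∈ Icc (0:ℝ) T, ∀ x ∈ D, ‖a t x‖ + ‖fderiv ℝ (a t) x‖ ≤ ρ) →
        ∀ w : ℝ → Euc d → ℝ, IsC12On (Icc 0 T) D w →
          (∀ t ∈ Icc (0:ℝ) T, ∀ x ∈ D, dtt w t x - ν * lapl (w t) x + divAW a w t x = 0) →
          DirichletBC (Icc 0 T) D w →
          L1norm D (w T) ≤ q * L1norm D (w 0) ∨
            ∀ x ∈ Pia, δ * L1norm D (w 0) ≤ |w T x| := by
  rcases Nat.eq_zero_or_pos d with rfl | hd
  · refine ⟨0, 1, zero_lt_one, one_pos, ?_⟩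
    intro a _ _ _ _ w hw hpde _
    refine Or.inr fun x hx => ?_
    rw [one_mul]
    exact L1norm_le_abs_of_dim_zero hT hw hpde (hP.2 (subset_closure hx))
  · obtain ⟨q, hq, h⟩ := exists_L1norm_le_mul hD.1 hD.2.2.1 ⟨0, hd⟩ hν hT hρ
    exact ⟨q, 1, hq, one_pos, fun a ha had hda haρ w hw hpde hbc =>
      Or.inl (h a ha had hda haρ w hw hpde hbc)⟩

end
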